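/- arXiv:1910.08899 — 2 statements merged into one kernel-verified Lean document; each statement's English description precedes it below -/
import Mathlib

section
/- Let R be a commutative ring with identity, let A ∈ M_{s×l}(R) have full rank over R, and let C_1,…,C_s be linear codes of length n over R with minimum Hamming distances d_1,…,d_s such that C_s ⊆ C_{s−1} ⊆ ⋯ ⊆ C_1. For i = 1,…,s let D_i be the minimum Hamming distance of the R-submodule C_{L_i} of R^l generated by the first i rows of A. Suppose that for every i = 1,…,s there exist x_i ∈ C_i and X_i ∈ C_{L_i} with wt(x_i) = d_i, wt(X_i) = D_i, and X_i x_i ≠ 0. Then d([C_1 … C_s]A) = min{d_1D_1, d_2D_2, …, d_sD_s}. -/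
open Matrix BigOperators

noncomputable section

/-- The linear map sending a tuple of codewords `(c_1, …, c_s)` (each in `R^n`)
to the `n × l` matrix `(c_1 … c_s) A`. -/
def mpcMap {R : Type*} [CommRing R] {s l n : ℕ} (A : Matrix (Fin s) (Fin l) R) :
    (Fin s → Fin n → R) →ₗ[R] Matrix (Fin n) (Fin l) R where
  toFun c := Matrix.of fun p t => ∑ i, c i p * A i t
  map_add' x y := by
    ext p t
    simp [add_mul, Finset.sum_add_distrib]
  map_smul' r x := by
    ext p t
    simp [Finset.mul_sum, mul_assoc]

/-- The matrix-product code `[C_1 … C_s] A`, viewed as a linear code of length `n·l`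
inside `M_{n×l}(R)`. -/
def matrixProductCode {R : Type*} [CommRing R] {s l n : ℕ}
    (C : Fin s → Submodule R (Fin n → R)) (A : Matrix (Fin s) (Fin l) R) :
    Submodule R (Matrix (Fin n) (Fin l) R) :=
  (Submodule.pi Set.univ C).map (mpcMap A)

/-- The (Euclidean) dual of a linear code `C ⊆ R^ι`. -/
def dualCode {R : Type*} [CommRing R] {ι : Type*} [Fintype ι] (C : Submodule R (ι → R)) :
    Submodule R (ι → R) where
  carrier := {x | ∀ y ∈ C, ∑ i, x i * y i = 0}
  add_mem' := by
    intro a b ha hb y hy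
    simp only [Set.mem_setOf_eq] at ha hb
    simp [Pi.add_apply, add_mul, Finset.sum_add_distrib, ha y hy, hb y hy]
  zero_mem' := by intro y hy; simp
  smul_mem' := by
    intro r a ha y hy
    simp only [Set.mem_setOf_eq] at ha
    simp [Pi.smul_apply, smul_eq_mul, mul_assoc, ← Finset.mul_sum, ha y hy]

/-- The dual of a code of `n × l` matrices, w.r.t. `⟨X,Y⟩ = tr (X Yᵀ) = ∑ᵢⱼ Xᵢⱼ Yᵢⱼ`. -/
def dualCodeMat {R : Type*} [CommRing R] {n l : ℕ}
    (C : Submodule R (Matrix (Fin n) (Fin l) R)) :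
    Submodule R (Matrix (Fin n) (Fin l) R) where
  carrier := {x | ∀ y ∈ C, ∑ i, ∑ j, x i j * y i j = 0}
  add_mem' := by
    intro a b ha hb y hy
    simp only [Set.mem_setOf_eq] at ha hb
    simp [Matrix.add_apply, add_mul, Finset.sum_add_distrib, ha y hy, hb y hy]
  zero_mem' := by intro y hy; simp
  smul_mem' := by
    intro r a ha y hy
    simp only [Set.mem_setOf_eq] at ha
    simp [Matrix.smul_apply, smul_eq_mul, mul_assoc, ← Finset.mul_sum, ha y hy]

/-- The minimum Hamming distance of a (linear) code `C ⊆ R^ι`: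
the minimal Hamming weight of a nonzero codeword. -/
def minDist {R : Type*} [Zero R] [DecidableEq R] {ι : Type*} [Fintype ι]
    (C : Set (ι → R)) : ℕ :=
  sInf (hammingNorm '' {c ∈ C | c ≠ 0})

/-- The Hamming weight of an `n × l` matrix: the number of its nonzero entries. -/
def matWt {R : Type*} [Zero R] [DecidableEq R] {n l : ℕ}
    (x : Matrix (Fin n) (Fin l) R) : ℕ :=
  hammingNorm fun p : Fin n × Fin l => x p.1 p.2

/-- The minimum Hamming distance of a code of `n × l` matrices
(regarded as words of length `n·l`). -/
def minDistMat {R : Type*} [Zero R] [DecidableEq R] {n l : ℕ}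
    (C : Set (Matrix (Fin n) (Fin l) R)) : ℕ :=
  sInf (matWt '' {c ∈ C | c ≠ 0})

end

noncomputable section

/-- `rowSpanCode A i` is the submodule `C_{L_i}` of `R^l` generated by the rows
`L_1, …, L_i` of `A` (in 0-indexed terms, the rows `A j` with `j ≤ i`). -/
def rowSpanCode {R : Type*} [CommRing R] {s l : ℕ} (A : Matrix (Fin s) (Fin l) R)
    (i : Fin s) : Submodule R (Fin l → R) :=
  Submodule.span R ((fun j => A j) '' {j : Fin s | j ≤ i})

end

lemma minDist_le_hammingNorm {R : Type*} [Zero R] [DecidableEq R] {ι : Type*} [Fintype ι]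
    {C : Set (ι → R)} {c : ι → R} (hc : c ∈ C) (h0 : c ≠ 0) : minDist C ≤ hammingNorm c :=
  Nat.sInf_le ⟨c, ⟨hc, h0⟩, rfl⟩

lemma minDistMat_le_matWt {R : Type*} [Zero R] [DecidableEq R] {n l : ℕ}
    {C : Set (Matrix (Fin n) (Fin l) R)} {M : Matrix (Fin n) (Fin l) R} (hM : M ∈ C)
    (h0 : M ≠ 0) : minDistMat C ≤ matWt M :=
  Nat.sInf_le ⟨M, ⟨hM, h0⟩, rfl⟩

lemma matWt_eq_sum_hammingNorm {R : Type*} [Zero R] [DecidableEq R] {n l : ℕ}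
    (M : Matrix (Fin n) (Fin l) R) : matWt M = ∑ p, hammingNorm (M p) := by
  simp only [matWt, hammingNorm, Finset.card_filter, Fintype.sum_prod_type]

lemma matWt_vecMulVec_le {R : Type*} [CommRing R] [DecidableEq R] {n l : ℕ}
    (x : Fin n → R) (X : Fin l → R) :
    matWt (vecMulVec x X) ≤ hammingNorm x * hammingNorm X := by
  simp only [matWt, hammingNorm, ← Finset.card_product]
  refine Finset.card_le_card fun p hp => ?_
  have hp : x p.1 * X p.2 ≠ 0 := (Finset.mem_filter.mp hp).2
  simp [left_ne_zero_of_mul hp, right_ne_zero_of_mul hp]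

lemma vecMulVec_mem_matrixProductCode {R : Type*} [CommRing R] {s l n : ℕ}
    {A : Matrix (Fin s) (Fin l) R} {C : Fin s → Submodule R (Fin n → R)} {i : Fin s}
    (hC : ∀ j ≤ i, C i ≤ C j) {x : Fin n → R} (hx : x ∈ C i) {X : Fin l → R}
    (hX : X ∈ rowSpanCode A i) : vecMulVec x X ∈ matrixProductCode C A := by
  induction hX using Submodule.span_induction with
  | mem Y hY =>
    obtain ⟨j, hj, rfl⟩ := hY
    refine ⟨Pi.single j x, fun k _ => ?_, ?_⟩
    · by_cases hk : k = j
      · subst hk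
        simpa using hC k hj hx
      · simp [hk]
    · ext p t
      simp only [mpcMap, LinearMap.coe_mk, AddHom.coe_mk, of_apply, vecMulVec_apply]
      rw [Finset.sum_eq_single j (fun k _ hk => by simp [hk]) (by simp)]
      simp
  | zero =>
    convert zero_mem (matrixProductCode C A) using 1
    ext p t
    simp [vecMulVec_apply]
  | add Y Z _ _ hY hZ =>
    rw [vecMulVec_add]
    exact add_mem hY hZ
  | smul a Y _ hY =>
    rw [vecMulVec_smul]
    exact Submodule.smul_mem _ a hY

lemma mpcMap_row {R : Type*} [CommRing R] {s l n : ℕ} (A : Matrix (Fin s) (Fin l) R)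
    (c : Fin s → Fin n → R) (p : Fin n) : mpcMap A c p = ∑ i, c i p • A i := by
  ext t
  simp [mpcMap]

/-- If `c_r` is the last nonzero constituent, then `(c_1 … c_s) A` has at least `wt(c_r)`
nonzero rows, and all of them lie in the code generated by the first `r` rows of `A`. -/
lemma hammingNorm_mul_minDist_le_matWt {R : Type*} [CommRing R] [DecidableEq R] {s l n : ℕ}
    {A : Matrix (Fin s) (Fin l) R} (hA : LinearIndependent R (fun i => A i))
    {c : Fin s → Fin n → R} {r : Fin s} (hr : ∀ j, r < j → c j = 0) :
    hammingNorm (c r) * minDist (rowSpanCode A r : Set (Fin l → R)) ≤ matWt (mpcMap A c) := by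
  rw [matWt_eq_sum_hammingNorm, hammingNorm, ← smul_eq_mul]
  refine (Finset.card_nsmul_le_sum _ (fun p => hammingNorm (mpcMap A c p)) _
    fun p hp => ?_).trans (Finset.sum_le_univ_sum_of_nonneg fun _ => Nat.zero_le _)
  have hp : c r p ≠ 0 := by simpa using hp
  refine minDist_le_hammingNorm ?_ fun h => hp ?_
  · rw [mpcMap_row]
    refine Submodule.sum_mem _ fun i _ => ?_
    by_cases hi : i ≤ r
    · exact Submodule.smul_mem _ _ (Submodule.subset_span ⟨i, hi, rfl⟩)
    · simp [hr i (not_le.mp hi)]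
  · rw [mpcMap_row] at h
    exact Fintype.linearIndependent_iff.mp hA (fun i => c i p) h r

lemma exists_minDist_mul_le_matWt {R : Type*} [CommRing R] [DecidableEq R] {s l n : ℕ}
    {A : Matrix (Fin s) (Fin l) R} (hA : LinearIndependent R (fun i => A i))
    {C : Fin s → Submodule R (Fin n → R)} {M : Matrix (Fin n) (Fin l) R}
    (hM : M ∈ matrixProductCode C A) (h0 : M ≠ 0) :
    ∃ i, minDist (C i : Set (Fin n → R)) * minDist (rowSpanCode A i : Set (Fin l → R)) ≤
      matWt M := by
  obtain ⟨c, hc, rfl⟩ := hM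
  have hne : ∃ j, c j ≠ 0 := by
    by_contra! h
    exact h0 (by rw [show c = 0 from funext h, map_zero])
  obtain ⟨r, hr⟩ := Set.toFinite {j | c j ≠ 0} |>.exists_maximal hne
  refine ⟨r, (Nat.mul_le_mul_right _ (minDist_le_hammingNorm (hc r trivial) hr.prop)).trans
    (hammingNorm_mul_minDist_le_matWt hA fun j hj => ?_)⟩
  by_contra hcj
  exact hr.not_prop_of_gt hj hcj

/-- Let `A ∈ M_{s×l}(R)` have full rank over a commutative ring `R` and
let `C_1, …, C_s` be linear codes of length `n` over `R` with `C_s ⊆ ⋯ ⊆ C_1`, with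
minimum distances `d_i = minDist (C i)`; let `D_i = minDist C_{L_i}` where `C_{L_i}` is
the span of the first `i` rows of `A`.  If for every `i` there are `x_i ∈ C_i` and
`X_i ∈ C_{L_i}` with `wt(x_i) = d_i`, `wt(X_i) = D_i` and `X_i x_i ≠ 0` (the product
`X x ∈ R^{l·n}` having entries `X_j · x_q`), then
`d([C_1 … C_s] A) = min_i (d_i · D_i)`. -/
theorem matrixProductCode_minDist_eq {R : Type*} [CommRing R] [DecidableEq R]
    {s l n : ℕ} (A : Matrix (Fin s) (Fin l) R)
    (hA : LinearIndependent R (fun i => A i))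
    (C : Fin s → Submodule R (Fin n → R))
    (hnested : ∀ i j : Fin s, i ≤ j → C j ≤ C i)
    (hexists : ∀ i : Fin s, ∃ x ∈ C i, ∃ X ∈ rowSpanCode A i,
      hammingNorm x = minDist (C i : Set (Fin n → R)) ∧
      hammingNorm X = minDist (rowSpanCode A i : Set (Fin l → R)) ∧
      (fun p : Fin l × Fin n => X p.1 * x p.2) ≠ 0) :
    minDistMat (matrixProductCode C A : Set (Matrix (Fin n) (Fin l) R)) =
      sInf {w : ℕ | ∃ i : Fin s,
        w = minDist (C i : Set (Fin n → R)) *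
            minDist (rowSpanCode A i : Set (Fin l → R))} := by
  have hle : ∀ i, ∃ M ∈ matrixProductCode C A, M ≠ 0 ∧ matWt M ≤
      minDist (C i : Set (Fin n → R)) * minDist (rowSpanCode A i : Set (Fin l → R)) := by
    intro i
    obtain ⟨x, hx, X, hX, hxd, hXD, h0⟩ := hexists i
    refine ⟨vecMulVec x X,
      vecMulVec_mem_matrixProductCode (fun j hj => hnested j i hj) hx hX, fun h => h0 ?_, ?_⟩
    · ext p
      rw [mul_comm]
      exact congrFun₂ h p.2 p.1
    · rw [← hxd, ← hXD]
      exact matWt_vecMulVec_le x X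
  rcases isEmpty_or_nonempty (Fin s) with hs | ⟨⟨i₀⟩⟩
  · have hcode : {M ∈ (matrixProductCode C A : Set (Matrix (Fin n) (Fin l) R)) | M ≠ 0} = ∅ :=
      Set.eq_empty_of_forall_notMem fun M hM =>
        hs.elim (exists_minDist_mul_le_matWt hA hM.1 hM.2).choose
    rw [minDistMat, hcode]
    simp
  · apply le_antisymm
    · refine le_csInf ⟨_, i₀, rfl⟩ ?_
      rintro _ ⟨i, rfl⟩
      obtain ⟨M, hM, h0, hw⟩ := hle i
      exact (minDistMat_le_matWt hM h0).trans hw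
    · obtain ⟨M₀, hM₀, h0₀, -⟩ := hle i₀
      refine le_csInf ⟨_, M₀, ⟨hM₀, h0₀⟩, rfl⟩ ?_
      rintro _ ⟨M, ⟨hM, h0⟩, rfl⟩
      obtain ⟨i, hi⟩ := exists_minDist_mul_le_matWt hA hM h0
      exact le_trans (Nat.sInf_le ⟨i, rfl⟩) hi
end

section
/- Let R be a finite commutative ring with identity, let A ∈ M_{s×s}(R) satisfy AA^T = Diag(r_1,…,r_s) with each r_i a unit of R, and let C_1,…,C_s be free linear codes over R of the same length n. Then the matrix-product code [C_1 … C_s]A is self-dual if and only if C_i is self-dual for every i = 1,…,s. -/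
open Matrix BigOperators

theorem mpcMap_eq_mul {R : Type*} [CommRing R] {s l n : ℕ} (A : Matrix (Fin s) (Fin l) R)
    (c : Fin s → Fin n → R) : mpcMap A c = (Matrix.of c)ᵀ * A := by
  ext p t
  simp [mpcMap, Matrix.mul_apply]

theorem mpcMap_bijective {R : Type*} [CommRing R] {s n : ℕ} {A : Matrix (Fin s) (Fin s) R}
    (hA : IsUnit A) : Function.Bijective (mpcMap (n := n) A) := by
  obtain ⟨B, hAB, hBA⟩ := isUnit_iff_exists.mp hA
  refine Function.bijective_iff_has_inverse.mpr
    ⟨fun M => Matrix.of.symm (M * B)ᵀ, fun c => ?_, fun M => ?_⟩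
  · simp [mpcMap_eq_mul, Matrix.mul_assoc, hAB]
  · simp [mpcMap_eq_mul, -Matrix.transpose_mul, Matrix.mul_assoc, hBA]

theorem sum_mpcMap_mul_mpcMap {R : Type*} [CommRing R] {s l n : ℕ}
    {A : Matrix (Fin s) (Fin l) R} {r : Fin s → R} (hA : A * Aᵀ = Matrix.diagonal r)
    (x y : Fin s → Fin n → R) :
    ∑ p, ∑ t, mpcMap A x p t * mpcMap A y p t = ∑ i, r i * ∑ p, x i p * y i p := by
  have key : mpcMap A x * (mpcMap A y)ᵀ =
      (Matrix.of x)ᵀ * Matrix.diagonal r * Matrix.of y := by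
    simp only [mpcMap_eq_mul, Matrix.transpose_mul, Matrix.transpose_transpose, ← hA,
      Matrix.mul_assoc]
  calc ∑ p, ∑ t, mpcMap A x p t * mpcMap A y p t
      = Matrix.trace (mpcMap A x * (mpcMap A y)ᵀ) := by
        simp [Matrix.trace, Matrix.mul_apply]
    _ = ∑ p, ∑ i, r i * (x i p * y i p) := by
        rw [key]
        simp only [Matrix.trace, Matrix.diag_apply, Matrix.mul_apply (N := Matrix.of y),
          Matrix.mul_diagonal, Matrix.transpose_apply, Matrix.of_apply]
        exact Finset.sum_congr rfl fun p _ => Finset.sum_congr rfl fun i _ => by ring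
    _ = ∑ i, r i * ∑ p, x i p * y i p := by
        rw [Finset.sum_comm]
        simp only [Finset.mul_sum]

theorem isUnit_of_mul_transpose_eq_diagonal {R : Type*} [CommRing R] {s : ℕ}
    {A : Matrix (Fin s) (Fin s) R} {r : Fin s → R} (hr : ∀ i, IsUnit (r i))
    (hA : A * Aᵀ = Matrix.diagonal r) : IsUnit A := by
  have hdet : IsUnit (A * Aᵀ).det := by
    rw [hA, Matrix.det_diagonal]
    exact IsUnit.prod_univ_iff.mpr hr
  rw [Matrix.det_mul] at hdet
  exact (Matrix.isUnit_iff_isUnit_det A).mpr (isUnit_of_mul_isUnit_left hdet)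

theorem dualCodeMat_matrixProductCode {R : Type*} [CommRing R] {s n : ℕ}
    {A : Matrix (Fin s) (Fin s) R} {r : Fin s → R} (hr : ∀ i, IsUnit (r i))
    (hA : A * Aᵀ = Matrix.diagonal r) (C : Fin s → Submodule R (Fin n → R)) :
    dualCodeMat (matrixProductCode C A) = matrixProductCode (fun i => dualCode (C i)) A := by
  have hbij := mpcMap_bijective (n := n) (isUnit_of_mul_transpose_eq_diagonal hr hA)
  ext M
  obtain ⟨x, rfl⟩ := hbij.surjective M
  have hmem : mpcMap A x ∈ matrixProductCode (fun i => dualCode (C i)) A ↔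
      x ∈ Submodule.pi Set.univ fun i => dualCode (C i) :=
    hbij.injective.mem_set_image
  rw [hmem]
  constructor
  · intro hx i _ y hy
    have h := hx _ (Submodule.mem_map_of_mem (f := mpcMap A)
      (Submodule.mem_pi.mpr fun j _ => ?_ : Pi.single i y ∈ Submodule.pi Set.univ C))
    · rw [sum_mpcMap_mul_mpcMap hA, Finset.sum_eq_single i] at h
      · simpa [(hr i).mul_right_eq_zero] using h
      · intro j _ hj
        simp [Pi.single_eq_of_ne hj]
      · simp
    · obtain rfl | hj := eq_or_ne j i
      · simpa using hy
      · simp [Pi.single_eq_of_ne hj]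
  · rintro hx _ ⟨y, hy, rfl⟩
    rw [sum_mpcMap_mul_mpcMap hA]
    refine Finset.sum_eq_zero fun i _ => ?_
    rw [hx i trivial (y i) (hy i trivial), mul_zero]

theorem Submodule.pi_univ_injective {R ι : Type*} [Semiring R] {M : ι → Type*}
    [∀ i, AddCommMonoid (M i)] [∀ i, Module R (M i)] :
    Function.Injective (Submodule.pi (R := R) (φ := M) Set.univ) := by
  intro p q h
  have hset : Set.univ.pi (fun i => (p i : Set (M i))) =
      Set.univ.pi fun i => (q i : Set (M i)) :=
    congrArg SetLike.coe h
  have hp : (Set.univ.pi fun i => (p i : Set (M i))).Nonempty := ⟨0, fun i _ => (p i).zero_mem⟩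
  funext i
  apply SetLike.coe_injective
  rw [← Set.eval_image_univ_pi hp, hset, Set.eval_image_univ_pi (hset ▸ hp)]

/-- Let `R` be a finite commutative ring and `A ∈ M_{s×s}(R)` with
`A Aᵀ = Diag(r_1, …, r_s)`, each `r_i` a unit, and let `C_1, …, C_s` be free linear
codes of length `n` over `R`.  Then `[C_1 … C_s] A` is self-dual if and only if every
`C_i` is self-dual. -/
theorem matrixProductCode_selfDual_iff {R : Type*} [CommRing R] [Fintype R] {s n : ℕ}
    (A : Matrix (Fin s) (Fin s) R) (r : Fin s → R) (hr : ∀ i, IsUnit (r i))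
    (hA : A * Aᵀ = Matrix.diagonal r)
    (C : Fin s → Submodule R (Fin n → R)) (hfree : ∀ i, Module.Free R (C i)) :
    matrixProductCode C A = dualCodeMat (matrixProductCode C A) ↔
      ∀ i, C i = dualCode (C i) := by
  have hbij := mpcMap_bijective (n := n) (isUnit_of_mul_transpose_eq_diagonal hr hA)
  rw [dualCodeMat_matrixProductCode hr hA, ← funext_iff]
  exact ((Submodule.map_injective_of_injective hbij.injective).comp
    Submodule.pi_univ_injective).eq_iff
end
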